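/- Let P = S ⊔ T with |S| ≥ 2 and |T| ≥ 2, fix p ∈ S and q ∈ T, and let L ⊆ V^P be the Lagrangian ⟨z_s + z_p : s ∈ S⟩ + ⟨Σ_{s∈S} x_s + z_q, z_p + Σ_{t∈T} x_t⟩ + ⟨z_t + z_q : t ∈ T⟩ (independent of the choices of p and q). Then for a suitable section σ the corresponding stabilizer state is |0⟩_S ⊗ |0⟩_T + |0⟩_S ⊗ |1⟩_T + |1⟩_S ⊗ |0⟩_T − |1⟩_S ⊗ |1⟩_T, where |b⟩_S := |b⋯b⟩ ∈ (ℂ²)^{⊗S}; the contiguity classes of L are exactly S and T, both protected, and hence the connected automorphism group A_c(L,σ) is a torus of dimension |P| − 2 > 0; in particular this pure stabilizer state has non-trivial connected automorphism group. -/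

import Mathlib

/- Common framework: binary stabilizer codes, local unitary/SO(3) automorphism groups. -/

noncomputable section
open scoped Matrix Real ComplexConjugate
open scoped Classical

namespace Stab

/-- The one-qubit phase space `V = 𝔽₂ ⊕ 𝔽₂`, with first coordinate the `z`-component
and second coordinate the `x`-component. -/
abbrev V : Type := ZMod 2 × ZMod 2

/-- The symplectic form on `V`. -/
def omegaV (u v : V) : ZMod 2 := u.1 * v.2 + u.2 * v.1

/-- The phase space `V^P` over a set of qubits `P`. -/
abbrev QV (P : Type) := P → V

variable {P : Type} [Fintype P] [DecidableEq P]

/-- The direct-sum symplectic form on `V^P`. -/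
def omega (u v : QV P) : ZMod 2 := ∑ p, omegaV (u p) (v p)

/-- A subspace `L ⊆ V^P` is isotropic if `ω` vanishes identically on `L × L`. -/
def Isotropic (L : Submodule (ZMod 2) (QV P)) : Prop := ∀ u ∈ L, ∀ v ∈ L, omega u v = 0

/-- Support of a vector of `V^P`. -/
def supp (v : QV P) : Set P := {p | v p ≠ 0}

/-- The basis vector `z_p`. -/
def zvec (p : P) : QV P := Pi.single p ((1 : ZMod 2), (0 : ZMod 2))

/-- The basis vector `x_p`. -/
def xvec (p : P) : QV P := Pi.single p ((0 : ZMod 2), (1 : ZMod 2))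

/-- Restriction (coordinate projection) of a vector to a subset `S ⊆ P`. -/
def restrTo (S : Set P) (v : QV P) : QV P := fun p => if p ∈ S then v p else 0

/-- The coordinate subspace `V^S ⊆ V^P`. -/
def coordSub (S : Set P) : Submodule (ZMod 2) (QV P) where
  carrier := {v | ∀ p ∉ S, v p = 0}
  add_mem' := by intro a b ha hb p hp; simp [Pi.add_apply, ha p hp, hb p hp]
  zero_mem' := by intro p _; rfl
  smul_mem' := by intro c a ha p hp; simp [Pi.smul_apply, ha p hp]

/-- `L_S := L ∩ V^S`. -/
def LS (L : Submodule (ZMod 2) (QV P)) (S : Set P) : Submodule (ZMod 2) (QV P) :=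
  L ⊓ coordSub S

/-- `L` splits as a direct factor on `S`, i.e. `L = L_S × L_{P∖S}`. -/
def SplitsOn (L : Submodule (ZMod 2) (QV P)) (S : Set P) : Prop :=
  ∀ v ∈ L, restrTo S v ∈ L

/-- `L` splits off a zero factor: on some nonempty `S ⊆ P` all vectors of `L` vanish. -/
def HasZeroFactor (L : Submodule (ZMod 2) (QV P)) : Prop :=
  ∃ S : Set P, S.Nonempty ∧ ∀ v ∈ L, ∀ p ∈ S, v p = 0

/-- The qubit `p` is trivial: `L` splits off a one-dimensional factor on `{p}`. -/
def TrivialQubit (L : Submodule (ZMod 2) (QV P)) (p : P) : Prop :=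
  SplitsOn L {p} ∧ ∃ v ∈ L, v ≠ 0 ∧ supp v ⊆ {p}

/-- `L` splits off a trivial factor. -/
def HasTrivialFactor (L : Submodule (ZMod 2) (QV P)) : Prop :=
  ∃ p : P, TrivialQubit L p

/-- `L` splits off a Bell Lagrangian: an indecomposable Lagrangian direct factor on a
two-element set of qubits (all of whose nonzero vectors have full support `{p, q}`). -/
def HasBellFactor (L : Submodule (ZMod 2) (QV P)) : Prop :=
  ∃ p q : P, p ≠ q ∧ SplitsOn L {p, q} ∧
    ∃ v ∈ L, ∃ w ∈ L, v ≠ w ∧ supp v = {p, q} ∧ supp w = {p, q} ∧ supp (v + w) = {p, q}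

/-- The factor `L_S` (for `S` in a partition) is indecomposable. -/
def IndecompWithin (L : Submodule (ZMod 2) (QV P)) (S : Set P) : Prop :=
  ∀ T ⊆ S, SplitsOn L T → T = ∅ ∨ T = S

/-! ### The Hilbert space, Pauli operators and stabilizer codes -/

/-- The state space `ℋ^{⊗P} = (ℂ²)^{⊗P}`, realised concretely as functions on
computational basis labels. -/
abbrev HP (P : Type) := (P → Fin 2) → ℂ

/-- Operators on `ℋ^{⊗P}` as matrices. -/
abbrev MatP (P : Type) := Matrix (P → Fin 2) (P → Fin 2) ℂ

/-- The tensor (local) operator `⊗_{p} g_p` on `ℋ^{⊗P}`. -/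
def locOp (g : P → Matrix (Fin 2) (Fin 2) ℂ) : MatP P :=
  Matrix.of fun u w => ∏ p, g p (u p) (w p)

def sigmaX : Matrix (Fin 2) (Fin 2) ℂ := !![0, 1; 1, 0]
def sigmaY : Matrix (Fin 2) (Fin 2) ℂ := !![0, -Complex.I; Complex.I, 0]
def sigmaZ : Matrix (Fin 2) (Fin 2) ℂ := !![1, 0; 0, -1]

/-- The one-qubit Pauli operator `Z^a X^b` attached to `(a, b) ∈ V`. -/
def pauliMat (v : V) : Matrix (Fin 2) (Fin 2) ℂ := sigmaZ ^ (v.1 : ZMod 2).val * sigmaX ^ (v.2 : ZMod 2).val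

/-- The Pauli (Weyl) operator attached to `v ∈ V^P`. -/
def Wop (v : QV P) : MatP P := locOp fun p => pauliMat (v p)

/-- A group-homomorphic section `σ` over `L` of the projection from the Pauli group
`Ṽ^P` onto `V^P`: each value `σ(v)` is a unitary scalar multiple of the Pauli operator
`W(v)`, and `σ` is multiplicative on `L`. -/
structure PauliSection (L : Submodule (ZMod 2) (QV P)) where
  toFun : QV P → MatP P
  scalar : ∀ v : QV P, ∃ c : ℂ, toFun v = c • Wop v
  unitary : ∀ v : QV P, toFun v ∈ Matrix.unitaryGroup (P → Fin 2) ℂ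
  mul_of_mem : ∀ u ∈ L, ∀ v ∈ L, toFun (u + v) = toFun u * toFun v
  map_zero : toFun 0 = 1

/-- The stabilizer code `C(L, σ)`: the common fixed-point space of the stabilizer
group `σ(L)`. -/
def code (L : Submodule (ZMod 2) (QV P)) (σ : PauliSection L) : Submodule ℂ (HP P) where
  carrier := {ψ | ∀ v ∈ L, σ.toFun v *ᵥ ψ = ψ}
  add_mem' := by intro a b ha hb v hv; rw [Matrix.mulVec_add, ha v hv, hb v hv]
  zero_mem' := by intro v hv; simp
  smul_mem' := by intro c a ha v hv; rw [Matrix.mulVec_smul, ha v hv]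

/-- The standard section: `σ(v) = W(v)` on `L`. -/
def StandardOn (L : Submodule (ZMod 2) (QV P)) (σ : PauliSection L) : Prop :=
  ∀ v ∈ L, σ.toFun v = Wop v

/-! ### `SO(3)`, rotations, and the automorphism group of a code -/

/-- `3×3` real matrices. -/
abbrev Rot : Type := Matrix (Fin 3) (Fin 3) ℝ

/-- `SO(3)` as a set of `3×3` real matrices. -/
def SO3 : Set Rot := {A | A * Aᵀ = 1 ∧ A.det = 1}

/-- The ordered Pauli basis (x, y, z) of traceless Hermitian `2×2` matrices. -/
def pauliBasis : Fin 3 → Matrix (Fin 2) (Fin 2) ℂ := ![sigmaX, sigmaY, sigmaZ]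

/-- The image of a unitary `u ∈ U(2)` in `SO(3)` under the adjoint action on traceless
Hermitian operators (the identification `U(2)/S¹ = SO(3)`):
`u σ_j u† = Σ_i (adjRot u)_{ij} σ_i`. -/
def adjRot (u : Matrix (Fin 2) (Fin 2) ℂ) : Rot :=
  Matrix.of fun i j =>
    (1 / 2 : ℝ) * ((pauliBasis i * u * pauliBasis j * u.conjTranspose).trace).re

/-- Rotation about the `x`-axis by angle `θ`. -/
def rotX (θ : ℝ) : Rot := !![1, 0, 0; 0, Real.cos θ, -Real.sin θ; 0, Real.sin θ, Real.cos θ]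

/-- Rotation about the `y`-axis by angle `θ`. -/
def rotY (θ : ℝ) : Rot := !![Real.cos θ, 0, Real.sin θ; 0, 1, 0; -Real.sin θ, 0, Real.cos θ]

/-- Rotation about the `z`-axis by angle `θ`. -/
def rotZ (θ : ℝ) : Rot := !![Real.cos θ, -Real.sin θ, 0; Real.sin θ, Real.cos θ, 0; 0, 0, 1]

/-- The circle group `C_x ⊆ SO(3)` of rotations about the `x`-axis. -/
def Cx : Set Rot := Set.range rotX

/-- The circle group `C_y ⊆ SO(3)` of rotations about the `y`-axis. -/
def Cy : Set Rot := Set.range rotY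

/-- The circle group `C_z ⊆ SO(3)` of rotations about the `z`-axis. -/
def Cz : Set Rot := Set.range rotZ

/-- The octahedral group: the subgroup of `SO(3)` generated by the rotations by a right
angle about the three coordinate axes. -/
def octahedral : Set Rot :=
  (Submonoid.closure {rotX (π / 2), rotY (π / 2), rotZ (π / 2)} : Submonoid Rot)

/-- The infinite dihedral group `D_x ⊆ SO(3)`. -/
def Dx : Set Rot := (Submonoid.closure (Cx ∪ {rotZ π}) : Submonoid Rot)

/-- The infinite dihedral group `D_y ⊆ SO(3)`. -/
def Dy : Set Rot := (Submonoid.closure (Cy ∪ {rotZ π}) : Submonoid Rot)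

/-- The infinite dihedral group `D_z ⊆ SO(3)`. -/
def Dz : Set Rot := (Submonoid.closure (Cz ∪ {rotX π}) : Submonoid Rot)

/-- The automorphism group `A(L, σ) ⊆ SO(3)^P` of the stabilizer code `C(L, σ)`:
all families of rotations admitting a local unitary lift mapping the code into itself. -/
def autSet (L : Submodule (ZMod 2) (QV P)) (σ : PauliSection L) : Set (P → Rot) :=
  {g | ∃ u : P → Matrix (Fin 2) (Fin 2) ℂ,
        (∀ p, u p ∈ Matrix.unitaryGroup (Fin 2) ℂ) ∧
        (∀ p, adjRot (u p) = g p) ∧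
        ∀ ψ ∈ code L σ, locOp u *ᵥ ψ ∈ code L σ}

/-- The automorphism group `A(L, σ)_p` at the qubit `p`. -/
def autSetAt (L : Submodule (ZMod 2) (QV P)) (σ : PauliSection L) (p : P) : Set Rot :=
  (fun g => g p) '' autSet L σ

/-- The normal subgroup `Z(L, σ)` of automorphisms acting by a scalar on the code. -/
def zSet (L : Submodule (ZMod 2) (QV P)) (σ : PauliSection L) : Set (P → Rot) :=
  {g | ∃ u : P → Matrix (Fin 2) (Fin 2) ℂ,
        (∀ p, u p ∈ Matrix.unitaryGroup (Fin 2) ℂ) ∧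
        (∀ p, adjRot (u p) = g p) ∧
        ∃ c : ℂ, ∀ ψ ∈ code L σ, locOp u *ᵥ ψ = c • ψ}

/-! ### Restriction to subsets of qubits -/

/-- Restriction of a phase-space vector to the qubits of `S`. -/
def resQV (S : Set P) (v : QV P) : QV ↥S := fun s => v s

/-- Restriction as a linear map. -/
def resLin (S : Set P) : QV P →ₗ[ZMod 2] QV ↥S where
  toFun := resQV S
  map_add' := by intros; rfl
  map_smul' := by intros; rfl

/-- `L_S`, regarded as a subspace of `V^S`. -/
def LSsub (L : Submodule (ZMod 2) (QV P)) (S : Set P) : Submodule (ZMod 2) (QV ↥S) :=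
  Submodule.map (resLin S) (LS L S)

/-- The extension `M ⊗ 1` to `ℋ^{⊗P}` of an operator `M` on `ℋ^{⊗S}`. -/
def extendOp (S : Set P) (M : Matrix (↥S → Fin 2) (↥S → Fin 2) ℂ) : MatP P :=
  Matrix.of fun u w =>
    if ∀ p ∉ S, u p = w p then M (fun s => u s) (fun s => w s) else 0

/-- `σ'` is the restriction `σ|_{L_S}` of the section `σ` to `L_S`. -/
def RestrictedSection (L : Submodule (ZMod 2) (QV P)) (σ : PauliSection L) (S : Set P)
    (σ' : PauliSection (LSsub L S)) : Prop :=
  ∀ v ∈ LS L S, extendOp S (σ'.toFun (resQV S v)) = σ.toFun v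

/-! ### Contiguity, protected and gauge qubits, and normal forms -/

/-- Two qubits are contiguous if they are equal or `L` contains a vector supported
exactly on the pair. -/
def Contig (L : Submodule (ZMod 2) (QV P)) (p q : P) : Prop :=
  p = q ∨ ∃ v ∈ L, supp v = ({p, q} : Set P)

/-- The contiguity class of a qubit. -/
def contigClass (L : Submodule (ZMod 2) (QV P)) (p : P) : Set P := {q | Contig L p q}

/-- The qubit `p` is protected: the projection `L → V^{{p}}` is surjective. -/
def IsProtected (L : Submodule (ZMod 2) (QV P)) (p : P) : Prop :=
  ∀ w : V, ∃ v ∈ L, v p = w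

/-- The qubit `p` is of gauge type: the projection `L → V^{{p}}` has a line as image. -/
def IsGauge (L : Submodule (ZMod 2) (QV P)) (p : P) : Prop :=
  ¬ IsProtected L p ∧ ∃ v ∈ L, v p ≠ 0

/-- The subspace `⟨z_a + z_b : a ≠ b ∈ S⟩`. -/
def zspan (S : Set P) : Submodule (ZMod 2) (QV P) :=
  Submodule.span (ZMod 2) {w | ∃ a ∈ S, ∃ b ∈ S, a ≠ b ∧ w = zvec a + zvec b}

/-- The vector `Σ_{s ∈ S} x_s`. -/
def xsumOn (S : Set P) : QV P := S.indicator fun _ => ((0 : ZMod 2), (1 : ZMod 2))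

/-- Normal form of `L` (conclusion of the normalisation lemma): every contiguity class `S`
carries either `⟨z_a + z_b⟩` or `⟨z_a + z_b⟩ + ⟨Σ_{s∈S} x_s⟩`. -/
def NormalForm (L : Submodule (ZMod 2) (QV P)) : Prop :=
  ∀ p : P,
    LS L (contigClass L p) = zspan (contigClass L p) ∨
    LS L (contigClass L p) =
      zspan (contigClass L p) ⊔ Submodule.span (ZMod 2) {xsumOn (contigClass L p)}

/-- The pair `(L, σ)` is normalised. -/
def Normalised (L : Submodule (ZMod 2) (QV P)) (σ : PauliSection L) : Prop :=
  NormalForm L ∧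
  (∀ p : P, IsGauge L p → contigClass L p = {p} → ∀ v ∈ L, (v p).2 = 0) ∧
  (∀ p : P, IsProtected L p → contigClass L p = {p} →
    connectedComponentIn (autSetAt L σ p) 1 ⊆ Cz) ∧
  (∀ p : P, IsProtected L p → contigClass L p ≠ {p} →
    LS L (contigClass L p) = zspan (contigClass L p) →
    ∃ v ∈ L, ∀ s ∈ contigClass L p, v s = ((0 : ZMod 2), (1 : ZMod 2))) ∧
  (∀ p q : P, p ≠ q → Contig L p q →
    σ.toFun (zvec p + zvec q) = Wop (zvec p + zvec q))

/-- A local symplectic family of automorphisms of `V`. -/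
def IsLocalSymp (f : P → (V ≃ₗ[ZMod 2] V)) : Prop :=
  ∀ (p : P) (u v : V), omegaV (f p u) (f p v) = omegaV u v

/-- The image of `L` under a local (symplectic) transformation. -/
def mapL (L : Submodule (ZMod 2) (QV P)) (f : P → (V ≃ₗ[ZMod 2] V)) :
    Submodule (ZMod 2) (QV P) :=
  Submodule.map (LinearEquiv.piCongrRight f : QV P ≃ₗ[ZMod 2] QV P).toLinearMap L

/-! ### Abstract group structures carried by subsets of a monoid -/

/-- The set `s` carries the structure of a solvable group. -/
structure SolvableGroupStructure (M : Type) [Monoid M] (s : Set M) where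
  G : Type
  [grp : Group G]
  solv : IsSolvable G
  f : G → M
  inj : Function.Injective f
  map_mul : ∀ a b : G, f (a * b) = f a * f b
  range_eq : Set.range f = s

/-- The quotient of the group (carried by) `A` by the normal subgroup (carried by) `Z`
is a compact solvable topological (Lie) group. -/
structure CompactSolvableQuotientStructure (M : Type) [Monoid M] [TopologicalSpace M]
    (A Z : Set M) where
  G : Type
  [grp : Group G]
  [top : TopologicalSpace G]
  [tgrp : IsTopologicalGroup G]
  cpt : CompactSpace G
  solv : IsSolvable G
  φ : M → G
  cont : ContinuousOn φ A
  map_mul' : ∀ a ∈ A, ∀ b ∈ A, φ (a * b) = φ a * φ b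
  surj : ∀ y : G, ∃ a ∈ A, φ a = y
  ker : ∀ a ∈ A, (φ a = 1 ↔ a ∈ Z)

/-! ### Logical qubits and transversally realisable gates -/

/-- The standard hermitian inner product on a finite-dimensional function space. -/
def innerF {ι : Type} [Fintype ι] (ψ φ : ι → ℂ) : ℂ := ∑ i, (starRingEnd ℂ) (ψ i) * φ i

/-- `e` is a unitary identification of the code space with a space of logical qubits. -/
def IsUnitaryEquiv (L : Submodule (ZMod 2) (QV P)) (σ : PauliSection L) {d : ℕ}
    (e : ↥(code L σ) ≃ₗ[ℂ] HP (Fin d)) : Prop :=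
  ∀ ψ φ : ↥(code L σ),
    innerF (e ψ) (e φ) = innerF (ψ : HP P) (φ : HP P)

/-- The operator acting as `w` on the logical qubit `k` and trivially elsewhere. -/
def oneQubitOp (d : ℕ) (k : Fin d) (w : Matrix (Fin 2) (Fin 2) ℂ) : MatP (Fin d) :=
  locOp fun j => if j = k then w else 1

/-- The set of rotations in `SO(3)` induced, via the identification `e`, on a fixed
logical qubit `k` by (exactly realised) transversal gates, i.e. by elements of `A(L, σ)`. -/
def logicalSet (L : Submodule (ZMod 2) (QV P)) (σ : PauliSection L) {d : ℕ}
    (e : ↥(code L σ) ≃ₗ[ℂ] HP (Fin d)) (k : Fin d) : Set Rot :=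
  {A | ∃ w ∈ Matrix.unitaryGroup (Fin 2) ℂ, adjRot w = A ∧
        ∃ u : P → Matrix (Fin 2) (Fin 2) ℂ,
          (∀ p, u p ∈ Matrix.unitaryGroup (Fin 2) ℂ) ∧
          ∀ φ : HP (Fin d),
            locOp u *ᵥ ((e.symm φ : HP P)) = ((e.symm (oneQubitOp d k w *ᵥ φ) : HP P))}

/-! ### Reed–Muller codes -/

/-- The qubit set `P = 𝔽₂^m ∖ {0}`. -/
abbrev RMQubits (m : ℕ) := {s : Fin m → ZMod 2 // s ≠ 0}

/-- Polynomial functions on `𝔽₂^m` of degree at most `r` with zero constant term. -/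
def RMspan (r m : ℕ) : Submodule (ZMod 2) ((Fin m → ZMod 2) → ZMod 2) :=
  Submodule.span (ZMod 2)
    {f | ∃ I : Finset (Fin m), I.Nonempty ∧ I.card ≤ r ∧ f = fun s => ∏ i ∈ I, s i}

/-- The shortened Reed–Muller code `R_*(r, m) ⊆ 𝔽₂^P`. -/
def RMstar (r m : ℕ) : Submodule (ZMod 2) (RMQubits m → ZMod 2) :=
  Submodule.map (LinearMap.funLeft (ZMod 2) (ZMod 2) Subtype.val) (RMspan r m)

/-- The `z`-part of a phase-space vector. -/
def zPart {P : Type} : QV P →ₗ[ZMod 2] (P → ZMod 2) where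
  toFun v := fun p => (v p).1
  map_add' := by intros; rfl
  map_smul' := by intros; rfl

/-- The `x`-part of a phase-space vector. -/
def xPart {P : Type} : QV P →ₗ[ZMod 2] (P → ZMod 2) where
  toFun v := fun p => (v p).2
  map_add' := by intros; rfl
  map_smul' := by intros; rfl

/-- The Calderbank–Shor–Steane isotropic subspace built from the shortened Reed–Muller
codes `R_*(m−2, m)` (in the `z`-coordinates) and `R_*(1, m)` (in the `x`-coordinates). -/
def cssL (m : ℕ) : Submodule (ZMod 2) (QV (RMQubits m)) :=
  Submodule.comap zPart (RMstar (m - 2) m) ⊓ Submodule.comap xPart (RMstar 1 m)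

/-- The stabilizer state `|0⟩_S ⊗ |0⟩_T + |0⟩_S ⊗ |1⟩_T + |1⟩_S ⊗ |0⟩_T − |1⟩_S ⊗ |1⟩_T`
(with `T = Sᶜ`), written in the computational basis. -/
def bellLike (S : Set P) (p q : P) : HP P := fun u =>
  if (∀ a ∈ S, u a = u p) ∧ (∀ a ∈ Sᶜ, u a = u q) then
    ((-1 : ℂ)) ^ ((u p : Fin 2).val * (u q : Fin 2).val) else 0


/-! ### Signs and Pauli operators -/

lemma eq_zero_or_one (x : ZMod 2) : x = 0 ∨ x = 1 := by
  revert x; decide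

/-- The character `x ↦ (-1)^x` of `𝔽₂`. -/
def sgn (x : ZMod 2) : ℂ := (-1) ^ x.val

lemma sgn_zero : sgn 0 = 1 := by simp [sgn]

lemma sgn_one : sgn 1 = -1 := by simp [sgn, ZMod.val_one]

lemma sgn_add (x y : ZMod 2) : sgn (x + y) = sgn x * sgn y := by
  have h : (1 + 1 : ZMod 2) = 0 := by decide
  obtain rfl | rfl := eq_zero_or_one x <;> obtain rfl | rfl := eq_zero_or_one y <;>
    simp [sgn_zero, sgn_one, h]

lemma sgn_mul_self (x : ZMod 2) : sgn x * sgn x = 1 := by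
  obtain rfl | rfl := eq_zero_or_one x <;> simp [sgn_zero, sgn_one]

lemma star_sgn (x : ZMod 2) : star (sgn x) = sgn x := by
  obtain rfl | rfl := eq_zero_or_one x <;> simp [sgn_zero, sgn_one]

lemma sgn_sum {ι : Type} (s : Finset ι) (f : ι → ZMod 2) :
    sgn (∑ i ∈ s, f i) = ∏ i ∈ s, sgn (f i) := by
  induction s using Finset.induction_on with
  | empty => simp [sgn_zero]
  | insert a s ha ih => rw [Finset.sum_insert ha, Finset.prod_insert ha, sgn_add, ih]

lemma locOp_mul (g h : P → Matrix (Fin 2) (Fin 2) ℂ) :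
    locOp g * locOp h = locOp fun a => g a * h a := by
  ext u w
  simp only [locOp, Matrix.mul_apply, Matrix.of_apply, ← Finset.prod_mul_distrib]
  rw [Finset.prod_univ_sum, Fintype.piFinset_univ]

lemma locOp_diagonal (d : P → Fin 2 → ℂ) :
    locOp (fun a => Matrix.diagonal (d a)) = Matrix.diagonal fun w => ∏ a, d a (w a) := by
  ext u w
  simp only [locOp, Matrix.of_apply, Matrix.diagonal_apply]
  by_cases h : u = w
  · subst h; simp
  · obtain ⟨a, ha⟩ := Function.ne_iff.1 h
    rw [if_neg h]
    exact Finset.prod_eq_zero (Finset.mem_univ a) (by simp [ha])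

lemma locOp_one : locOp (fun _ : P => 1) = 1 := by
  have := locOp_diagonal (P := P) fun _ _ => 1
  simpa using this

lemma locOp_star (g : P → Matrix (Fin 2) (Fin 2) ℂ) :
    star (locOp g) = locOp fun a => star (g a) := by
  ext u w
  simp [locOp, Matrix.star_apply]

lemma locOp_smul (c : P → ℂ) (g : P → Matrix (Fin 2) (Fin 2) ℂ) :
    locOp (fun a => c a • g a) = (∏ a, c a) • locOp g := by
  ext u w
  simp [locOp, Finset.prod_mul_distrib]

lemma star_locOp_mul_self {g : P → Matrix (Fin 2) (Fin 2) ℂ}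
    (hg : ∀ a, g a ∈ Matrix.unitaryGroup (Fin 2) ℂ) : star (locOp g) * locOp g = 1 := by
  simp only [locOp_star, locOp_mul, fun a => Matrix.mem_unitaryGroup_iff'.1 (hg a), locOp_one]

/-- An operator acting on the single qubit `a`. -/
def singleOp (a : P) (M : Matrix (Fin 2) (Fin 2) ℂ) : MatP P :=
  locOp (Function.update (fun _ => 1) a M)

lemma singleOp_mulVec (a : P) (M : Matrix (Fin 2) (Fin 2) ℂ) (φ : HP P) (w : P → Fin 2) :
    (singleOp a M *ᵥ φ) w = ∑ k, M (w a) k * φ (Function.update w a k) := by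
  have hinj : Function.Injective fun k => Function.update w a k :=
    Function.update_injective w a
  rw [Matrix.mulVec, dotProduct, ← Finset.sum_subset
    (Finset.subset_univ (Finset.univ.image fun k => Function.update w a k)),
    Finset.sum_image (fun _ _ _ _ h => hinj h)]
  · refine Finset.sum_congr rfl fun k _ => ?_
    congr 1
    simp only [singleOp, locOp, Matrix.of_apply]
    rw [Finset.prod_eq_single a]
    · simp
    · intro b _ hb; simp [hb]
    · simp
  · intro w' _ hw'
    have : ∃ b, b ≠ a ∧ w b ≠ w' b := by
      by_contra! h
      refine hw' (Finset.mem_image.2 ⟨w' a, Finset.mem_univ _, ?_⟩)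
      ext1 b
      by_cases hb : b = a
      · subst hb; simp
      · simp [hb, h b hb]
    obtain ⟨b, hb, hne⟩ := this
    simp only [singleOp, locOp, Matrix.of_apply]
    rw [Finset.prod_eq_zero (Finset.mem_univ b), zero_mul]
    simp [hb, hne]

/-- A computational basis label, as an element of `𝔽₂`. -/
def toBit (i : Fin 2) : ZMod 2 := i

/-- The translate of a computational basis label by an element of `𝔽₂`. -/
def shift (i : Fin 2) (b : ZMod 2) : Fin 2 := (toBit i + b : ZMod 2)

lemma toBit_zero : toBit 0 = 0 := rfl

lemma toBit_one : toBit 1 = 1 := rfl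

lemma toBit_shift (i : Fin 2) (b : ZMod 2) : toBit (shift i b) = toBit i + b := rfl

lemma toBit_injective : Function.Injective toBit := fun _ _ h => h

lemma shift_zero (i : Fin 2) : shift i 0 = i := toBit_injective (by simp [toBit_shift])

lemma shift_one_one : shift 1 1 = 0 := rfl

lemma shift_zero_one : shift 0 1 = 1 := rfl

lemma pauliMat_apply (v : V) (i j : Fin 2) :
    pauliMat v i j = sgn (v.1 * toBit i) * if j = shift i v.2 then 1 else 0 := by
  obtain ⟨a, b⟩ := v
  obtain rfl | rfl := eq_zero_or_one a <;> obtain rfl | rfl := eq_zero_or_one b <;>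
    fin_cases i <;> fin_cases j <;>
    simp [pauliMat, sigmaZ, sigmaX, sgn_zero, sgn_one, ZMod.val_one, toBit_zero, toBit_one,
      shift_zero, shift_zero_one, shift_one_one]

lemma pauliMat_mul (u v : V) :
    pauliMat u * pauliMat v = sgn (u.2 * v.1) • pauliMat (u + v) := by
  ext i j
  have h : ∀ k, k = shift i u.2 ∧ j = shift k v.2 ↔ k = shift i u.2 ∧ j = shift i (u + v).2 := by
    refine fun k => and_congr_right fun hk => ?_
    rw [← toBit_injective.eq_iff, ← toBit_injective.eq_iff (b := shift i _), hk]
    simp only [toBit_shift, Prod.snd_add, add_assoc]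
  simp only [Matrix.mul_apply, Matrix.smul_apply, pauliMat_apply, smul_eq_mul]
  rw [Finset.sum_eq_single (shift i u.2)]
  · have := h (shift i u.2)
    simp only [true_and] at this
    simp only [if_true, this, toBit_shift, mul_add, sgn_add, Prod.fst_add, add_mul]
    rw [mul_comm v.1 u.2]
    ring
  · intro k _ hk; simp [hk]
  · simp

lemma pauliMat_zero : pauliMat 0 = 1 := by simp [pauliMat]

lemma pauliMat_mem (v : V) : pauliMat v ∈ Matrix.unitaryGroup (Fin 2) ℂ := by
  have hz : sigmaZ ∈ Matrix.unitaryGroup (Fin 2) ℂ := by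
    rw [Matrix.mem_unitaryGroup_iff]
    ext i j; fin_cases i <;> fin_cases j <;> simp [sigmaZ, Matrix.mul_apply, Matrix.star_apply]
  have hx : sigmaX ∈ Matrix.unitaryGroup (Fin 2) ℂ := by
    rw [Matrix.mem_unitaryGroup_iff]
    ext i j; fin_cases i <;> fin_cases j <;> simp [sigmaX, Matrix.mul_apply, Matrix.star_apply]
  exact mul_mem (pow_mem hz _) (pow_mem hx _)

lemma Wop_zero : Wop (0 : QV P) = 1 := by
  simp only [Wop, Pi.zero_apply, pauliMat_zero, locOp_one]

lemma Wop_mul (u v : QV P) :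
    Wop u * Wop v = sgn (∑ a, (u a).2 * (v a).1) • Wop (u + v) := by
  simp only [Wop, locOp_mul, pauliMat_mul, locOp_smul, sgn_sum, Pi.add_apply]

lemma Wop_mulVec (v : QV P) (φ : HP P) (w : P → Fin 2) :
    (Wop v *ᵥ φ) w = sgn (∑ a, (v a).1 * toBit (w a)) * φ fun a => shift (w a) (v a).2 := by
  have h : ∀ w', Wop v w w' =
      if w' = fun a => shift (w a) (v a).2 then sgn (∑ a, (v a).1 * toBit (w a)) else 0 := by
    intro w'
    simp only [Wop, locOp, Matrix.of_apply, pauliMat_apply, Finset.prod_mul_distrib, ← sgn_sum]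
    split_ifs with hw
    · subst hw; simp
    · obtain ⟨a, ha⟩ := Function.ne_iff.1 hw
      rw [Finset.prod_eq_zero (Finset.mem_univ a) (by simp [ha]), mul_zero]
  simp [Matrix.mulVec, dotProduct, h]

lemma smul_Wop_mem (x : ZMod 2) (v : QV P) :
    sgn x • Wop v ∈ Matrix.unitaryGroup (P → Fin 2) ℂ := by
  rw [Matrix.mem_unitaryGroup_iff', star_smul, star_sgn, smul_mul_smul_comm, sgn_mul_self, one_smul]
  exact star_locOp_mul_self fun a => pauliMat_mem _

/-! ### The Lagrangian -/

/-- The Lagrangian `⟨z_s + z_p⟩ + ⟨Σ_{s∈S} x_s + z_q, z_p + Σ_{t∉S} x_t⟩ + ⟨z_t + z_q⟩`. -/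
def bellLagrangian (S : Set P) (p q : P) : Submodule (ZMod 2) (QV P) :=
  Submodule.span (ZMod 2)
      (({v | ∃ s ∈ S, v = zvec s + zvec p} : Set (QV P)) ∪
        ({xsumOn S + zvec q, zvec p + xsumOn Sᶜ} : Set (QV P)) ∪
        ({v | ∃ t ∈ Sᶜ, v = zvec t + zvec q} : Set (QV P)))

lemma zvec_fst (a b : P) : (zvec a b).1 = if b = a then 1 else 0 := by
  by_cases h : b = a <;> simp [zvec, h]

lemma zvec_snd (a b : P) : (zvec a b).2 = 0 := by
  by_cases h : b = a <;> simp [zvec, h]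

lemma xsumOn_fst (S : Set P) (a : P) : (xsumOn S a).1 = 0 := by
  by_cases h : a ∈ S <;> simp [xsumOn, h]

lemma xsumOn_snd (S : Set P) (a : P) : (xsumOn S a).2 = if a ∈ S then 1 else 0 := by
  by_cases h : a ∈ S <;> simp [xsumOn, h]

/-- The finset of elements of a set of qubits. -/
def qubits (S : Set P) : Finset P := Finset.univ.filter (· ∈ S)

lemma mem_qubits {S : Set P} {a : P} : a ∈ qubits S ↔ a ∈ S := by simp [qubits]

@[to_additive]
lemma prod_qubits_mul_prod_compl {M : Type} [CommMonoid M] (S : Set P) (f : P → M) :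
    (∏ a ∈ qubits S, f a) * ∏ a ∈ qubits Sᶜ, f a = ∏ a, f a := by
  have h : qubits Sᶜ = (qubits S)ᶜ := by ext; simp [mem_qubits]
  rw [h, Finset.prod_mul_prod_compl]

lemma bellLagrangian_symm (S : Set P) (p q : P) :
    bellLagrangian S p q = bellLagrangian Sᶜ q p := by
  unfold bellLagrangian
  rw [compl_compl, Set.union_right_comm, Set.union_comm {v | ∃ s ∈ S, v = zvec s + zvec p},
    Set.union_right_comm, Set.pair_comm, add_comm (zvec p), add_comm (xsumOn S)]

lemma bellLike_symm (S : Set P) (p q : P) : bellLike S p q = bellLike Sᶜ q p := by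
  ext w
  simp only [bellLike, compl_compl, and_comm, mul_comm]

section Lagrangian

variable {S : Set P} {p q : P}

lemma zvec_add_zvec_mem {a b : P} (ha : a ∈ S) (hb : b ∈ S) :
    zvec a + zvec b ∈ bellLagrangian S p q := by
  have h : ∀ c ∈ S, zvec c + zvec p ∈ bellLagrangian S p q := fun c hc =>
    Submodule.subset_span (Or.inl (Or.inl ⟨c, hc, rfl⟩))
  have h2 : zvec p + zvec p = (0 : QV P) := by
    rw [← two_nsmul, ← Nat.cast_smul_eq_nsmul (ZMod 2)]
    exact zero_smul _ _
  have := add_mem (h a ha) (h b hb)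
  rwa [add_add_add_comm, h2, add_zero] at this

lemma xsumOn_add_zvec_mem : xsumOn S + zvec q ∈ bellLagrangian S p q :=
  Submodule.subset_span (Or.inl (Or.inr (Or.inl rfl)))

lemma xpart_eq_and_sum_zpart (hp : p ∈ S) (hq : q ∉ S) {v : QV P}
    (hv : v ∈ bellLagrangian S p q) :
    (∀ a ∈ S, (v a).2 = (v p).2) ∧ ∑ a ∈ qubits S, (v a).1 = (v q).2 := by
  have h2 : (1 + 1 : ZMod 2) = 0 := by decide
  induction hv using Submodule.span_induction with
  | mem v hv =>
    rcases hv with (⟨s, hs, rfl⟩ | rfl | rfl) | ⟨t, ht, rfl⟩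
    · simp [zvec_fst, zvec_snd, Finset.sum_add_distrib, mem_qubits, hs, hp, h2]
    · simp +contextual [zvec_fst, zvec_snd, xsumOn_fst, xsumOn_snd, mem_qubits, hp, hq]
    · simp +contextual [zvec_fst, zvec_snd, xsumOn_fst, xsumOn_snd, mem_qubits, hp, hq]
    · simp [zvec_fst, zvec_snd, Finset.sum_add_distrib, mem_qubits, hq, show t ∉ S from ht]
  | zero => simp
  | add u v _ _ hu hv =>
    refine ⟨fun a ha => ?_, ?_⟩
    · simp [hu.1 a ha, hv.1 a ha]
    · simp [Finset.sum_add_distrib, hu.2, hv.2]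
  | smul c v _ hv =>
    refine ⟨fun a ha => ?_, ?_⟩
    · simp [hv.1 a ha]
    · simp [← Finset.mul_sum, hv.2]

lemma xpart_eq_and_sum_zpart_compl (hp : p ∈ S) (hq : q ∉ S) {v : QV P}
    (hv : v ∈ bellLagrangian S p q) :
    (∀ a ∉ S, (v a).2 = (v q).2) ∧ ∑ a ∈ qubits Sᶜ, (v a).1 = (v p).2 :=
  xpart_eq_and_sum_zpart (S := Sᶜ) hq (fun h => h hp) (bellLagrangian_symm S p q ▸ hv)

lemma exists_ne_of_two_le (h : 2 ≤ S.ncard) (a : P) : ∃ b ∈ S, b ≠ a :=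
  Set.exists_ne_of_one_lt_ncard h a

lemma contig_iff (hS : 2 ≤ S.ncard) (hT : 2 ≤ Sᶜ.ncard) (hp : p ∈ S) (hq : q ∉ S) {a : P}
    (ha : a ∈ S) (b : P) : Contig (bellLagrangian S p q) a b ↔ b ∈ S := by
  refine ⟨?_, fun hb => ?_⟩
  · rintro (rfl | ⟨v, hv, hsupp⟩)
    · exact ha
    by_contra hb
    have hzero : ∀ c, c ≠ a → c ≠ b → v c = 0 := by
      intro c hca hcb
      by_contra hc
      have : c ∈ supp v := hc
      rw [hsupp] at this
      rcases this with h | h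
      · exact hca h
      · exact hcb h
    have hva : v a ≠ 0 := by
      have : a ∈ supp v := by rw [hsupp]; exact Or.inl rfl
      exact this
    obtain ⟨h1, h2⟩ := xpart_eq_and_sum_zpart hp hq hv
    obtain ⟨h3, -⟩ := xpart_eq_and_sum_zpart_compl hp hq hv
    obtain ⟨c, hc, hca⟩ := exists_ne_of_two_le hS a
    obtain ⟨d, hd, hdb⟩ := exists_ne_of_two_le hT b
    have hx : (v p).2 = 0 := by
      rw [← h1 c hc, hzero c hca (fun h => hb (h ▸ hc))]; rfl
    have hxq : (v q).2 = 0 := by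
      rw [← h3 d hd, hzero d (fun h => hd (h ▸ ha)) hdb]; rfl
    rw [Finset.sum_eq_single_of_mem a (mem_qubits.2 ha), hxq] at h2
    · exact hva (Prod.ext h2 ((h1 a ha).trans hx))
    · intro c hc hca
      rw [hzero c hca (fun h => hb (h ▸ mem_qubits.1 hc))]; rfl
  · by_cases hab : a = b
    · exact Or.inl hab
    refine Or.inr ⟨_, zvec_add_zvec_mem ha hb, ?_⟩
    ext c
    by_cases hca : c = a
    · subst hca; simp [supp, zvec, hab]
    · by_cases hcb : c = b
      · subst hcb; simp [supp, zvec, hca]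
      · simp [supp, zvec, hca, hcb]

lemma isProtected_of_mem (hS : 2 ≤ S.ncard) (hq : q ∉ S) {a : P} (ha : a ∈ S) :
    IsProtected (bellLagrangian S p q) a := by
  intro w
  obtain ⟨b, hb, hba⟩ := exists_ne_of_two_le hS a
  have haq : a ≠ q := fun h => hq (h ▸ ha)
  refine ⟨w.1 • (zvec a + zvec b) + w.2 • (xsumOn S + zvec q),
    add_mem (Submodule.smul_mem _ _ (zvec_add_zvec_mem ha hb))
      (Submodule.smul_mem _ _ xsumOn_add_zvec_mem), ?_⟩
  ext <;> simp [zvec_fst, zvec_snd, xsumOn_fst, xsumOn_snd, ha, hba.symm, haq]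

lemma sum_xpart_mul_zpart (hp : p ∈ S) (hq : q ∉ S) {v : QV P}
    (hv : v ∈ bellLagrangian S p q) {f : P → ZMod 2} (hfS : ∀ a ∈ S, f a = f p)
    (hfT : ∀ a ∉ S, f a = f q) :
    ∑ a, f a * (v a).1 = f p * (v q).2 + f q * (v p).2 := by
  rw [← sum_qubits_add_sum_compl S, ← (xpart_eq_and_sum_zpart hp hq hv).2,
    ← (xpart_eq_and_sum_zpart_compl hp hq hv).2, Finset.mul_sum, Finset.mul_sum]
  congr 1
  · exact Finset.sum_congr rfl fun a ha => by rw [hfS a (mem_qubits.1 ha)]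
  · exact Finset.sum_congr rfl fun a ha => by rw [hfT a (mem_qubits.1 ha)]

/-- The section `v ↦ (-1)^{x_p(v) x_q(v)} W(v)` over the Lagrangian. -/
def bellSection (hp : p ∈ S) (hq : q ∉ S) : PauliSection (bellLagrangian S p q) where
  toFun v := sgn ((v p).2 * (v q).2) • Wop v
  scalar v := ⟨_, rfl⟩
  unitary v := smul_Wop_mem _ v
  mul_of_mem u hu v hv := by
    rw [smul_mul_smul_comm, Wop_mul, smul_smul, sum_xpart_mul_zpart hp hq hv
      (xpart_eq_and_sum_zpart hp hq hu).1 (xpart_eq_and_sum_zpart_compl hp hq hu).1,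
      ← sgn_add, ← sgn_add]
    congr 2
    simp only [Pi.add_apply, Prod.snd_add]
    ring
  map_zero := by simp [Wop_zero, sgn_zero]

/-- The basis label which is `i` on `S` and `j` off `S`. -/
def blockLabel (S : Set P) (i j : Fin 2) : P → Fin 2 := fun a => if a ∈ S then i else j

lemma eq_blockLabel {w : P → Fin 2} (h : (∀ a ∈ S, w a = w p) ∧ ∀ a ∈ Sᶜ, w a = w q) :
    w = blockLabel S (w p) (w q) := by
  ext1 a
  by_cases ha : a ∈ S
  · simp [blockLabel, ha, h.1 a ha]
  · simp [blockLabel, ha, h.2 a ha]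

lemma bellLike_eq (w : P → Fin 2) : bellLike S p q w =
    if (∀ a ∈ S, w a = w p) ∧ ∀ a ∈ Sᶜ, w a = w q then sgn (toBit (w p) * toBit (w q)) else 0 := by
  have h : ∀ i j : Fin 2, (-1 : ℂ) ^ (i.val * j.val) = sgn (toBit i * toBit j) := by
    intro i j
    fin_cases i <;> fin_cases j <;> simp [toBit_zero, toBit_one, sgn_zero, sgn_one]
  simp only [bellLike, h]

lemma bellLike_blockLabel (hp : p ∈ S) (hq : q ∉ S) (i j : Fin 2) :
    bellLike S p q (blockLabel S i j) = sgn (toBit i * toBit j) := by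
  rw [bellLike_eq, if_pos]
  · simp [blockLabel, hp, hq]
  · exact ⟨fun a ha => by simp [blockLabel, hp, ha],
      fun a ha => by simp [blockLabel, hq, show a ∉ S from ha]⟩

lemma shift_left_injective (b : ZMod 2) : Function.Injective fun i => shift i b := by
  intro i j h
  have h' : toBit (shift i b) = toBit (shift j b) := congrArg toBit h
  rw [toBit_shift, toBit_shift, add_left_inj] at h'
  exact toBit_injective h'

lemma bellLike_mem_code (hp : p ∈ S) (hq : q ∉ S) :
    bellLike S p q ∈ code (bellLagrangian S p q) (bellSection hp hq) := by
  intro v hv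
  have hS := (xpart_eq_and_sum_zpart hp hq hv).1
  have hT := (xpart_eq_and_sum_zpart_compl hp hq hv).1
  ext w
  simp only [bellSection, Matrix.smul_mulVec, Pi.smul_apply, smul_eq_mul, Wop_mulVec, bellLike_eq]
  have hiff : ((∀ a ∈ S, shift (w a) (v a).2 = shift (w p) (v p).2) ∧
      ∀ a ∈ Sᶜ, shift (w a) (v a).2 = shift (w q) (v q).2) ↔
      (∀ a ∈ S, w a = w p) ∧ ∀ a ∈ Sᶜ, w a = w q := by
    refine and_congr (forall₂_congr fun a ha => ?_) (forall₂_congr fun a ha => ?_)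
    · rw [hS a ha]; exact (shift_left_injective _).eq_iff
    · rw [hT a ha]; exact (shift_left_injective _).eq_iff
  rw [if_congr hiff rfl rfl]
  split_ifs with h
  · have hsum := sum_xpart_mul_zpart hp hq hv (f := fun a => toBit (w a))
      (fun a ha => by rw [h.1 a ha]) (fun a ha => by rw [h.2 a ha])
    simp only [mul_comm (v _).1]
    rw [hsum, ← sgn_add, ← sgn_add]
    congr 1
    simp only [toBit_shift]
    ring_nf
    have h2 : (2 : ZMod 2) = 0 := by decide
    simp [h2]
  · simp

lemma code_bellSection_apply_eq_zero (hp : p ∈ S) (hq : q ∉ S) {φ : HP P}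
    (hφ : φ ∈ code (bellLagrangian S p q) (bellSection hp hq)) {v : QV P}
    (hv : v ∈ bellLagrangian S p q) (hx : ∀ a, (v a).2 = 0) {w : P → Fin 2}
    (hw : ∑ a, (v a).1 * toBit (w a) = 1) : φ w = 0 := by
  have h := congrFun (hφ v hv) w
  simp only [bellSection, Matrix.smul_mulVec, Pi.smul_apply, smul_eq_mul, Wop_mulVec, hw, hx,
    mul_zero, sgn_zero, sgn_one, one_mul, shift_zero] at h
  linear_combination (-1 / 2 : ℂ) * h

lemma toBit_add_toBit_of_ne {i j : Fin 2} (h : i ≠ j) : toBit i + toBit j = 1 := by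
  revert i j; decide

lemma sum_zvec_fst_mul (a : P) (f : P → ZMod 2) : ∑ b, (zvec a b).1 * f b = f a := by
  simp [zvec_fst]

lemma code_bellSection_blockLabel (hp : p ∈ S) (hq : q ∉ S) {φ : HP P}
    (hφ : φ ∈ code (bellLagrangian S p q) (bellSection hp hq)) (j : Fin 2) :
    sgn (toBit j) * φ (blockLabel S 1 j) = φ (blockLabel S 0 j) := by
  have h := congrFun (hφ _ xsumOn_add_zvec_mem) (blockLabel S 0 j)
  have hs : (fun a => shift (blockLabel S 0 j a) ((xsumOn S + zvec q) a).2) =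
      blockLabel S 1 j := by
    ext1 a
    by_cases ha : a ∈ S <;>
      simp [blockLabel, ha, xsumOn_snd, zvec_snd, shift_zero, shift_zero_one]
  simp only [bellSection, Matrix.smul_mulVec, Pi.smul_apply, smul_eq_mul, Wop_mulVec, hs] at h
  rw [← h]
  simp only [Pi.add_apply, Prod.fst_add, Prod.snd_add, xsumOn_fst, xsumOn_snd, zvec_snd, hq,
    if_false, zero_add, sum_zvec_fst_mul, mul_zero, add_zero, sgn_zero, one_mul]
  simp [blockLabel, hq]

lemma code_bellSection_blockLabel_compl (hp : p ∈ S) (hq : q ∉ S) {φ : HP P}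
    (hφ : φ ∈ code (bellLagrangian S p q) (bellSection hp hq)) (i : Fin 2) :
    sgn (toBit i) * φ (blockLabel S i 1) = φ (blockLabel S i 0) := by
  have hmem : xsumOn Sᶜ + zvec p ∈ bellLagrangian S p q :=
    bellLagrangian_symm S p q ▸ xsumOn_add_zvec_mem
  have h := congrFun (hφ _ hmem) (blockLabel S i 0)
  have hs : (fun a => shift (blockLabel S i 0 a) ((xsumOn Sᶜ + zvec p) a).2) =
      blockLabel S i 1 := by
    ext1 a
    by_cases ha : a ∈ S <;>
      simp [blockLabel, ha, xsumOn_snd, zvec_snd, shift_zero, shift_zero_one]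
  simp only [bellSection, Matrix.smul_mulVec, Pi.smul_apply, smul_eq_mul, Wop_mulVec, hs] at h
  rw [← h]
  simp only [Pi.add_apply, Prod.fst_add, Prod.snd_add, xsumOn_fst, xsumOn_snd, zvec_snd, hp,
    Set.mem_compl_iff, not_true, if_false, zero_add, sum_zvec_fst_mul, zero_mul, add_zero,
    sgn_zero, one_mul]
  simp [blockLabel, hp]

lemma code_bellSection (hp : p ∈ S) (hq : q ∉ S) :
    code (bellLagrangian S p q) (bellSection hp hq) = Submodule.span ℂ {bellLike S p q} := by
  refine le_antisymm (fun φ hφ => ?_)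
    (Submodule.span_le.2 (Set.singleton_subset_iff.2 (bellLike_mem_code hp hq)))
  refine Submodule.mem_span_singleton.2 ⟨φ (blockLabel S 0 0), ?_⟩
  ext w
  rw [Pi.smul_apply, smul_eq_mul]
  by_cases h : (∀ a ∈ S, w a = w p) ∧ ∀ a ∈ Sᶜ, w a = w q
  · rw [eq_blockLabel h, bellLike_blockLabel hp hq]
    have h0 := code_bellSection_blockLabel hp hq hφ 0
    have h1 := code_bellSection_blockLabel_compl hp hq hφ 0
    have h2 := code_bellSection_blockLabel_compl hp hq hφ 1
    simp only [toBit_zero, toBit_one, sgn_zero, sgn_one, one_mul] at h0 h1 h2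
    generalize w p = i
    generalize w q = j
    fin_cases i <;> fin_cases j <;> simp [toBit_zero, toBit_one, sgn_zero, sgn_one]
    · exact h1.symm
    · exact h0.symm
    · linear_combination h0 + h2
  · rw [bellLike_eq, if_neg h, mul_zero]
    rw [not_and_or] at h
    push Not at h
    obtain ⟨a, ha, hne⟩ | ⟨a, ha, hne⟩ := h
    · refine (code_bellSection_apply_eq_zero hp hq hφ
        (zvec_add_zvec_mem ha hp) (fun b => by simp [zvec_snd]) ?_).symm
      simp only [Pi.add_apply, Prod.fst_add, add_mul, Finset.sum_add_distrib, sum_zvec_fst_mul,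
        toBit_add_toBit_of_ne hne]
    · refine (code_bellSection_apply_eq_zero hp hq hφ (v := zvec a + zvec q)
        (bellLagrangian_symm S p q ▸ zvec_add_zvec_mem ha hq) (fun b => by simp [zvec_snd]) ?_).symm
      simp only [Pi.add_apply, Prod.fst_add, add_mul, Finset.sum_add_distrib, sum_zvec_fst_mul,
        toBit_add_toBit_of_ne hne]

end Lagrangian

/-! ### Local unitaries fixing the stabilizer state -/

lemma adjRot_zz (u : Matrix (Fin 2) (Fin 2) ℂ) : adjRot u 2 2 =
    1 / 2 * (u 0 0 * star (u 0 0) - u 0 1 * star (u 0 1) - u 1 0 * star (u 1 0)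
      + u 1 1 * star (u 1 1)).re := by
  simp [adjRot, pauliBasis, sigmaZ, Matrix.trace_fin_two, Matrix.mul_apply,
    Matrix.conjTranspose_apply]
  ring

lemma adjRot_zz_eq_neg_one_or {u : Matrix (Fin 2) (Fin 2) ℂ}
    (hu : u ∈ Matrix.unitaryGroup (Fin 2) ℂ) (h : (u * sigmaZ * star u) 1 0 = 0) :
    adjRot u 2 2 = -1 ∨ adjRot u 2 2 = 1 ∧ u = Matrix.diagonal fun i => u i i := by
  have hU := Matrix.mem_unitaryGroup_iff.1 hu
  have h00 := congrFun₂ hU 0 0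
  have h10 := congrFun₂ hU 1 0
  have h11 := congrFun₂ hU 1 1
  simp only [Matrix.mul_apply, Fin.sum_univ_two, Matrix.star_apply, Matrix.one_apply_eq,
    sigmaZ, Matrix.of_apply, Matrix.cons_val_zero, Matrix.cons_val_one, Matrix.cons_val',
    Matrix.cons_val_fin_one, mul_zero, mul_one, add_zero, zero_add, mul_neg, neg_mul,
    Matrix.one_apply_ne (show (1 : Fin 2) ≠ 0 by decide)] at h00 h10 h11 h
  have e1 : u 1 0 * star (u 0 0) = 0 := by linear_combination (1 / 2 : ℂ) * (h10 + h)
  have e2 : u 1 1 * star (u 0 1) = 0 := by linear_combination (1 / 2 : ℂ) * (h10 - h)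
  rw [adjRot_zz]
  by_cases hz : u 1 0 = 0
  · have h1 : u 1 1 ≠ 0 := by rintro h1; simp [hz, h1] at h11
    have h2 : u 0 1 = 0 := by simpa [h1] using e2
    simp only [hz, h2, zero_mul, add_zero, zero_add, sub_zero] at h00 h11 ⊢
    refine Or.inr ⟨by rw [h00, h11]; norm_num, ?_⟩
    ext i j
    fin_cases i <;> fin_cases j <;> simp [hz, h2]
  · have h1 : u 0 0 = 0 := by simpa [hz] using e1
    simp only [h1, zero_mul, zero_add] at h00
    have h2 : u 0 1 ≠ 0 := by rintro h2; simp [h2] at h00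
    have h3 : u 1 1 = 0 := by simpa [h2] using e2
    simp only [h3, zero_mul, add_zero] at h11
    left
    rw [h00, h11, h1, h3]
    norm_num

/-- The rotation about the `z`-axis whose angle is the argument of the unit `z`. -/
def rotC (z : ℂ) : Rot := !![z.re, -z.im, 0; z.im, z.re, 0; 0, 0, 1]

lemma adjRot_diagonal {d : Fin 2 → ℂ} (h : ∀ i, d i * star (d i) = 1) :
    adjRot (Matrix.diagonal d) = rotC (d 1 * star (d 0)) := by
  have h0 := congrArg Complex.re (h 0)
  have h1 := congrArg Complex.re (h 1)
  simp at h0 h1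
  ext i j
  fin_cases i <;> fin_cases j <;>
    simp [adjRot, rotC, pauliBasis, sigmaX, sigmaY, sigmaZ, Matrix.trace_fin_two,
      Matrix.mul_apply, Matrix.diagonal_apply] <;>
    linarith

lemma rotC_injective : Function.Injective rotC := by
  intro z w h
  have h0 := congrFun₂ h 0 0
  have h1 := congrFun₂ h 1 0
  simp [rotC] at h0 h1
  exact Complex.ext h0 h1

lemma continuous_rotC : Continuous rotC := by
  refine continuous_matrix fun i j => ?_
  fin_cases i <;> fin_cases j <;> simp [rotC] <;> fun_prop

lemma sigmaZ_conj_mulVec_eq {u : P → Matrix (Fin 2) (Fin 2) ℂ}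
    (hu : ∀ a, u a ∈ Matrix.unitaryGroup (Fin 2) ℂ) {ψ : HP P} (hψ : ψ ≠ 0) {c : ℂ}
    (hc : locOp u *ᵥ ψ = c • ψ) {a b : P}
    (hab : singleOp a sigmaZ *ᵥ ψ = singleOp b sigmaZ *ᵥ ψ) :
    singleOp a (u a * sigmaZ * star (u a)) *ᵥ ψ =
      singleOp b (u b * sigmaZ * star (u b)) *ᵥ ψ := by
  have hc0 : c ≠ 0 := by
    rintro rfl
    apply hψ
    rw [← Matrix.one_mulVec ψ, ← star_locOp_mul_self hu, ← Matrix.mulVec_mulVec, hc, zero_smul,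
      Matrix.mulVec_zero]
  have hcomm : ∀ a, singleOp a (u a * sigmaZ * star (u a)) * locOp u =
      locOp u * singleOp a sigmaZ := by
    intro a
    simp only [singleOp, locOp_mul]
    congr 1
    ext1 b
    by_cases hb : b = a
    · subst hb
      simp [mul_assoc, Matrix.mem_unitaryGroup_iff'.1 (hu b)]
    · simp [hb]
  have key : ∀ a, c • (singleOp a (u a * sigmaZ * star (u a)) *ᵥ ψ) =
      locOp u *ᵥ (singleOp a sigmaZ *ᵥ ψ) := by
    intro a
    rw [Matrix.mulVec_mulVec, ← hcomm, ← Matrix.mulVec_mulVec, hc, Matrix.mulVec_smul]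
  exact smul_right_injective _ hc0 (by simp only [key, hab])

section Automorphisms

variable {S : Set P} {p q : P}

lemma bellLike_eq_zero {a b : P} (ha : a ∈ S) (hb : b ∈ S) {w : P → Fin 2} (h : w a ≠ w b) :
    bellLike S p q w = 0 := by
  rw [bellLike_eq, if_neg]
  exact fun hw => h ((hw.1 a ha).trans (hw.1 b hb).symm)

lemma bellLike_ne_zero (hp : p ∈ S) (hq : q ∉ S) : bellLike S p q ≠ 0 := by
  intro h
  have := congrFun h (blockLabel S 0 0)
  simp [bellLike_blockLabel hp hq, toBit_zero, sgn_zero] at this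

lemma sigmaZ_mulVec_bellLike {a b : P} (ha : a ∈ S) (hb : b ∈ S) :
    singleOp a sigmaZ *ᵥ bellLike S p q = singleOp b sigmaZ *ᵥ bellLike S p q := by
  have h : ∀ c w, (singleOp c sigmaZ *ᵥ bellLike S p q) w =
      sigmaZ (w c) (w c) * bellLike S p q w := by
    intro c w
    rw [singleOp_mulVec, Finset.sum_eq_single (w c), Function.update_eq_self]
    · intro k _ hk
      have : sigmaZ (w c) k = 0 := by
        revert hk
        generalize w c = i
        fin_cases i <;> fin_cases k <;> simp [sigmaZ]
      rw [this, zero_mul]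
    · simp
  ext w
  rw [h, h]
  by_cases hw : w a = w b
  · rw [hw]
  · rw [bellLike_eq_zero ha hb hw, mul_zero, mul_zero]

lemma bellLike_update_pair (hp : p ∈ S) (hq : q ∉ S) {a b : P} (ha : a ∈ S) (hb : b ∈ S) :
    bellLike S p q (Function.update (Function.update (blockLabel S 0 1) a 1) b 1) =
      -bellLike S p q (Function.update (Function.update (blockLabel S 0 0) a 1) b 1) := by
  by_cases h : ∃ c ∈ S, c ≠ a ∧ c ≠ b
  · obtain ⟨c, hc, hca, hcb⟩ := h
    rw [bellLike_eq_zero hb hc, bellLike_eq_zero hb hc, neg_zero] <;>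
      simp [hca, hcb, blockLabel, hc]
  · push Not at h
    have hw : ∀ j, Function.update (Function.update (blockLabel S 0 j) a 1) b 1 =
        blockLabel S 1 j := by
      intro j
      ext1 c
      by_cases hcb : c = b
      · subst hcb; simp [blockLabel, hb]
      by_cases hca : c = a
      · subst hca; simp [blockLabel, hcb, ha]
      have hc : c ∉ S := fun hc => hcb (h c hc hca)
      simp [blockLabel, hca, hcb, hc]
    rw [hw, hw, bellLike_blockLabel hp hq, bellLike_blockLabel hp hq]
    simp [toBit_zero, toBit_one, sgn_zero, sgn_one]

lemma adjRot_zz_of_mulVec_bellLike (hS : 2 ≤ S.ncard) (hp : p ∈ S) (hq : q ∉ S)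
    {u : P → Matrix (Fin 2) (Fin 2) ℂ} (hu : ∀ a, u a ∈ Matrix.unitaryGroup (Fin 2) ℂ) {c : ℂ}
    (hc : locOp u *ᵥ bellLike S p q = c • bellLike S p q) {a : P} (ha : a ∈ S) :
    adjRot (u a) 2 2 = -1 ∨
      adjRot (u a) 2 2 = 1 ∧ u a = Matrix.diagonal fun i => u a i i := by
  obtain ⟨b, hb, hba⟩ := exists_ne_of_two_le hS a
  refine adjRot_zz_eq_neg_one_or (hu a) ?_
  have h := sigmaZ_conj_mulVec_eq hu (bellLike_ne_zero hp hq) hc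
    (sigmaZ_mulVec_bellLike ha hb)
  have key : ∀ j, (u a * sigmaZ * star (u a)) 1 0 =
      (u b * sigmaZ * star (u b)) 0 1 *
        bellLike S p q (Function.update (Function.update (blockLabel S 0 j) a 1) b 1) := by
    intro j
    have hj := congrFun h (Function.update (blockLabel S 0 j) a 1)
    have h1 : Function.update (blockLabel S 0 j) a 0 = blockLabel S 0 j :=
      Function.update_eq_self_iff.2 (by simp [blockLabel, ha])
    have h2 : bellLike S p q (Function.update (blockLabel S 0 j) a 1) = 0 :=
      bellLike_eq_zero ha hb (by simp [hba, blockLabel, hb])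
    have h3 : Function.update (Function.update (blockLabel S 0 j) a 1) b 0 =
        Function.update (blockLabel S 0 j) a 1 :=
      Function.update_eq_self_iff.2 (by simp [hba, blockLabel, hb])
    have h4 : Function.update (blockLabel S 0 j) a 1 b = 0 := by simp [hba, blockLabel, hb]
    simp only [singleOp_mulVec, Fin.sum_univ_two, Function.update_self, Function.update_idem,
      h1, h2, h3, h4, bellLike_blockLabel hp hq, toBit_zero, zero_mul, sgn_zero, mul_one, mul_zero,
      add_zero, zero_add] at hj
    exact hj
  have k0 := key 0
  have k1 := key 1
  rw [bellLike_update_pair hp hq ha hb] at k1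
  linear_combination (1 / 2 : ℂ) * (k0 + k1)

lemma diagonal_mulVec_blockLabel (hp : p ∈ S) (hq : q ∉ S) (d : P → Fin 2 → ℂ) (i j : Fin 2) :
    (locOp (fun a => Matrix.diagonal (d a)) *ᵥ bellLike S p q) (blockLabel S i j) =
      ((∏ a ∈ qubits S, d a i) * ∏ a ∈ qubits Sᶜ, d a j) * sgn (toBit i * toBit j) := by
  rw [locOp_diagonal, Matrix.mulVec_diagonal, bellLike_blockLabel hp hq,
    ← prod_qubits_mul_prod_compl S]
  congr 2
  · refine Finset.prod_congr rfl fun a ha => ?_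
    simp [blockLabel, mem_qubits.1 ha]
  · refine Finset.prod_congr rfl fun a ha => ?_
    simp [blockLabel, show a ∉ S from mem_qubits.1 ha]

lemma prod_div_eq_one_of_mulVec_bellLike (hp : p ∈ S) (hq : q ∉ S) {d : P → Fin 2 → ℂ}
    (hd : ∀ a i, d a i * star (d a i) = 1) {c : ℂ}
    (hc : locOp (fun a => Matrix.diagonal (d a)) *ᵥ bellLike S p q = c • bellLike S p q) :
    ∏ a ∈ qubits S, d a 1 * star (d a 0) = 1 := by
  have h0 := congrFun hc (blockLabel S 0 0)
  have h1 := congrFun hc (blockLabel S 1 0)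
  rw [diagonal_mulVec_blockLabel hp hq, Pi.smul_apply, bellLike_blockLabel hp hq] at h0 h1
  simp only [toBit_zero, mul_zero, sgn_zero, mul_one] at h0 h1
  have hne : ∏ a ∈ qubits Sᶜ, d a 0 ≠ 0 :=
    Finset.prod_ne_zero_iff.2 fun a _ h => by simpa [h] using hd a 0
  have := mul_right_cancel₀ hne (h1.trans h0.symm)
  rw [Finset.prod_mul_distrib, this, ← Finset.prod_mul_distrib]
  exact Finset.prod_eq_one fun a _ => hd a 0

lemma rotC_mem_autSet (hp : p ∈ S) (hq : q ∉ S) {z : P → Circle}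
    (hzS : ∏ a ∈ qubits S, z a = 1) (hzT : ∏ a ∈ qubits Sᶜ, z a = 1) :
    (fun a => rotC (z a)) ∈ autSet (bellLagrangian S p q) (bellSection hp hq) := by
  have hd : ∀ a i, (![1, (z a : ℂ)] : Fin 2 → ℂ) i *
      star ((![1, (z a : ℂ)] : Fin 2 → ℂ) i) = 1 := by
    intro a i
    fin_cases i
    · simp
    · simp [Complex.mul_conj]
  have hprod : ∀ (s : Finset P), ∏ a ∈ s, z a = 1 →
      ∀ i, ∏ a ∈ s, (![1, (z a : ℂ)] : Fin 2 → ℂ) i = 1 := by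
    intro s hs i
    fin_cases i
    · simp
    · exact (map_prod Circle.coeHom z s).symm.trans (by rw [hs, map_one])
  refine ⟨fun a => Matrix.diagonal ![1, (z a : ℂ)], fun a => ?_, fun a => ?_, fun ψ hψ => ?_⟩
  · rw [Matrix.mem_unitaryGroup_iff, Matrix.star_eq_conjTranspose, Matrix.diagonal_conjTranspose,
      Matrix.diagonal_mul_diagonal, ← Matrix.diagonal_one]
    exact congrArg _ (funext (hd a))
  · rw [adjRot_diagonal (hd a)]
    simp
  · suffices h : locOp (fun a => Matrix.diagonal ![1, (z a : ℂ)]) *ᵥ bellLike S p q =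
        bellLike S p q by
      rw [code_bellSection] at hψ
      obtain ⟨c, rfl⟩ := Submodule.mem_span_singleton.1 hψ
      rw [Matrix.mulVec_smul, h]
      exact Submodule.smul_mem _ _ (bellLike_mem_code hp hq)
    ext w
    by_cases h : (∀ a ∈ S, w a = w p) ∧ ∀ a ∈ Sᶜ, w a = w q
    · rw [eq_blockLabel h, diagonal_mulVec_blockLabel hp hq, hprod _ hzS, hprod _ hzT,
        bellLike_blockLabel hp hq, one_mul, one_mul]
    · rw [locOp_diagonal, Matrix.mulVec_diagonal, bellLike_eq, if_neg h, mul_zero]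

lemma exists_mulVec_bellLike (hp : p ∈ S) (hq : q ∉ S) {u : P → Matrix (Fin 2) (Fin 2) ℂ}
    (hu : ∀ ψ ∈ code (bellLagrangian S p q) (bellSection hp hq),
      locOp u *ᵥ ψ ∈ code (bellLagrangian S p q) (bellSection hp hq)) :
    ∃ c : ℂ, locOp u *ᵥ bellLike S p q = c • bellLike S p q := by
  have h := hu _ (bellLike_mem_code hp hq)
  rw [code_bellSection] at h
  obtain ⟨c, hc⟩ := Submodule.mem_span_singleton.1 h
  exact ⟨c, hc.symm⟩

lemma adjRot_zz_of_preserves_code (hS : 2 ≤ S.ncard) (hT : 2 ≤ Sᶜ.ncard) (hp : p ∈ S)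
    (hq : q ∉ S) {u : P → Matrix (Fin 2) (Fin 2) ℂ}
    (hu : ∀ a, u a ∈ Matrix.unitaryGroup (Fin 2) ℂ)
    (huc : ∀ ψ ∈ code (bellLagrangian S p q) (bellSection hp hq),
      locOp u *ᵥ ψ ∈ code (bellLagrangian S p q) (bellSection hp hq)) (a : P) :
    adjRot (u a) 2 2 = -1 ∨
      adjRot (u a) 2 2 = 1 ∧ u a = Matrix.diagonal fun i => u a i i := by
  obtain ⟨c, hc⟩ := exists_mulVec_bellLike hp hq huc
  by_cases ha : a ∈ S
  · exact adjRot_zz_of_mulVec_bellLike hS hp hq hu hc ha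
  · rw [bellLike_symm] at hc
    exact adjRot_zz_of_mulVec_bellLike (S := Sᶜ) hT hq (fun h => h hp) hu hc ha

lemma autSet_zz (hS : 2 ≤ S.ncard) (hT : 2 ≤ Sᶜ.ncard) (hp : p ∈ S) (hq : q ∉ S)
    {g : P → Rot} (hg : g ∈ autSet (bellLagrangian S p q) (bellSection hp hq)) (a : P) :
    g a 2 2 = -1 ∨ g a 2 2 = 1 := by
  obtain ⟨u, hu, hug, huc⟩ := hg
  rw [← hug]
  exact (adjRot_zz_of_preserves_code hS hT hp hq hu huc a).imp_right And.left

lemma exists_eq_rotC_of_mem_autSet (hS : 2 ≤ S.ncard) (hT : 2 ≤ Sᶜ.ncard) (hp : p ∈ S)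
    (hq : q ∉ S) {g : P → Rot} (hg : g ∈ autSet (bellLagrangian S p q) (bellSection hp hq))
    (hneg : ∀ a, g a 2 2 ≠ -1) :
    ∃ z : P → Circle, ∏ a ∈ qubits S, z a = 1 ∧
      ∏ a ∈ qubits Sᶜ, z a = 1 ∧ g = fun a => rotC (z a) := by
  obtain ⟨u, hu, hug, huc⟩ := hg
  obtain ⟨c, hc⟩ := exists_mulVec_bellLike hp hq huc
  have hdiag : ∀ a, u a = Matrix.diagonal fun i => u a i i := fun a =>
    ((adjRot_zz_of_preserves_code hS hT hp hq hu huc a).resolve_left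
      (by rw [hug]; exact hneg a)).2
  obtain ⟨d, rfl⟩ : ∃ d : P → Fin 2 → ℂ, u = fun a => Matrix.diagonal (d a) :=
    ⟨fun a i => u a i i, funext hdiag⟩
  have hd : ∀ a i, d a i * star (d a i) = 1 := by
    intro a i
    have h := Matrix.mem_unitaryGroup_iff.1 (hu a)
    rw [Matrix.star_eq_conjTranspose, Matrix.diagonal_conjTranspose,
      Matrix.diagonal_mul_diagonal, ← Matrix.diagonal_one] at h
    exact congrFun (Matrix.diagonal_injective h) i
  have hc' : locOp (fun a => Matrix.diagonal (d a)) *ᵥ bellLike Sᶜ q p = c • bellLike Sᶜ q p := by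
    rwa [← bellLike_symm]
  have hnorm : ∀ a i, ‖d a i‖ = 1 := by
    intro a i
    have h := congrArg norm (hd a i)
    rw [norm_mul, norm_star, norm_one] at h
    nlinarith [norm_nonneg (d a i)]
  let z : P → Circle := fun a => ⟨d a 1 * star (d a 0), by
    rw [Submonoid.unitSphere, Submonoid.mem_mk, Subsemigroup.mem_mk, mem_sphere_zero_iff_norm,
      norm_mul, norm_star, hnorm, hnorm, one_mul]⟩
  have hz : ∀ s : Finset P, ∏ a ∈ s, d a 1 * star (d a 0) = 1 → ∏ a ∈ s, z a = 1 := by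
    intro s hs
    refine Circle.coe_injective ?_
    exact (map_prod Circle.coeHom z s).trans hs
  refine ⟨z, hz _ (prod_div_eq_one_of_mulVec_bellLike hp hq hd hc),
    hz _ (prod_div_eq_one_of_mulVec_bellLike (S := Sᶜ) hq (fun h => h hp) hd hc'), ?_⟩
  ext1 a
  rw [← hug a, adjRot_diagonal (hd a)]

/-! ### The torus -/

/-- Extension by `1` of a family of units indexed by the qubits other than `p` and `q`. -/
def extendOne (y : {a : P // a ≠ p ∧ a ≠ q} → Circle) (a : P) : Circle :=
  if h : a ≠ p ∧ a ≠ q then y ⟨a, h⟩ else 1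

/-- Extension of a family of units so that its products over `S` and over `Sᶜ` are `1`. -/
def extendCircle (S : Set P) (y : {a : P // a ≠ p ∧ a ≠ q} → Circle) : P → Circle :=
  extendOne y * Pi.mulSingle p (∏ a ∈ qubits S, extendOne y a)⁻¹ *
    Pi.mulSingle q (∏ a ∈ qubits Sᶜ, extendOne y a)⁻¹

lemma prod_extendCircle (hp : p ∈ S) (hq : q ∉ S) (y : {a : P // a ≠ p ∧ a ≠ q} → Circle) :
    ∏ a ∈ qubits S, extendCircle S y a = 1 := by
  simp [extendCircle, Finset.prod_mul_distrib, Finset.prod_pi_mulSingle', mem_qubits, hp, hq]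

lemma prod_compl_extendCircle (hp : p ∈ S) (hq : q ∉ S)
    (y : {a : P // a ≠ p ∧ a ≠ q} → Circle) :
    ∏ a ∈ qubits Sᶜ, extendCircle S y a = 1 := by
  simp [extendCircle, Finset.prod_mul_distrib, Finset.prod_pi_mulSingle', mem_qubits, hp, hq]

lemma extendCircle_apply (y : {a : P // a ≠ p ∧ a ≠ q} → Circle)
    (a : {a : P // a ≠ p ∧ a ≠ q}) : extendCircle S y a = y a := by
  simp [extendCircle, extendOne, a.2.1, a.2.2]

lemma exists_extendCircle_eq (hp : p ∈ S) (hq : q ∉ S) {z : P → Circle}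
    (hzS : ∏ a ∈ qubits S, z a = 1) (hzT : ∏ a ∈ qubits Sᶜ, z a = 1) :
    ∃ y : {a : P // a ≠ p ∧ a ≠ q} → Circle, extendCircle S y = z := by
  have hpq : p ≠ q := fun h => hq (h ▸ hp)
  refine ⟨fun a => z a, ?_⟩
  have hz : z = extendOne (p := p) (q := q) (fun a => z a) * Pi.mulSingle p (z p) *
      Pi.mulSingle q (z q) := by
    ext1 a
    by_cases hap : a = p
    · subst hap; simp [extendOne, hpq]
    by_cases haq : a = q
    · subst haq; simp [extendOne, hap]
    simp [extendOne, hap, haq]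
  have h1 : (∏ a ∈ qubits S, extendOne (p := p) (q := q) (fun a => z a) a)⁻¹ = z p := by
    rw [hz] at hzS
    simp only [Pi.mul_apply, Finset.prod_mul_distrib, Finset.prod_pi_mulSingle', mem_qubits, hp,
      hq, if_true, if_false, mul_one] at hzS
    exact inv_eq_of_mul_eq_one_right hzS
  have h2 : (∏ a ∈ qubits Sᶜ, extendOne (p := p) (q := q) (fun a => z a) a)⁻¹ = z q := by
    rw [hz] at hzT
    simp only [Pi.mul_apply, Finset.prod_mul_distrib, Finset.prod_pi_mulSingle', mem_qubits, hp,
      hq, Set.mem_compl_iff, not_true, not_false_iff, if_true, if_false, mul_one] at hzT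
    exact inv_eq_of_mul_eq_one_right hzT
  rw [extendCircle, h1, h2]
  exact hz.symm

lemma continuous_extendCircle (S : Set P) :
    Continuous (extendCircle S : ({a : P // a ≠ p ∧ a ≠ q} → Circle) → P → Circle) := by
  have h : Continuous (extendOne : ({a : P // a ≠ p ∧ a ≠ q} → Circle) → P → Circle) := by
    refine continuous_pi fun a => ?_
    by_cases ha : a ≠ p ∧ a ≠ q
    · simpa only [extendOne, dif_pos ha] using continuous_apply _
    · simpa only [extendOne, dif_neg ha] using continuous_const
  have h' : ∀ s : Finset P, Continuous fun y : {a : P // a ≠ p ∧ a ≠ q} → Circle =>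
      (∏ a ∈ s, extendOne y a)⁻¹ := fun s =>
    (continuous_finsetProd _ fun a _ => (continuous_apply a).comp h).inv
  exact (h.mul ((continuous_mulSingle p).comp (h' _))).mul ((continuous_mulSingle q).comp (h' _))

/-- The torus of `z`-rotations fixing the stabilizer state. -/
def torusMap (S : Set P) (y : {a : P // a ≠ p ∧ a ≠ q} → Circle) : P → Rot :=
  fun a => rotC (extendCircle S y a)

lemma continuous_torusMap (S : Set P) :
    Continuous (torusMap S : ({a : P // a ≠ p ∧ a ≠ q} → Circle) → P → Rot) :=
  continuous_pi fun a => continuous_rotC.comp <| continuous_subtype_val.comp <|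
    (continuous_apply a).comp (continuous_extendCircle S)

lemma torusMap_injective (S : Set P) :
    Function.Injective (torusMap S : ({a : P // a ≠ p ∧ a ≠ q} → Circle) → P → Rot) := by
  intro y y' h
  ext1 a
  have ha := Circle.ext (rotC_injective (congrFun h a))
  rwa [extendCircle_apply, extendCircle_apply] at ha

lemma torusMap_one (S : Set P) :
    torusMap S (1 : {a : P // a ≠ p ∧ a ≠ q} → Circle) = 1 := by
  have h : extendOne (1 : {a : P // a ≠ p ∧ a ≠ q} → Circle) = 1 := by
    ext1 a; simp [extendOne]
  ext a i j
  fin_cases i <;> fin_cases j <;> simp [torusMap, extendCircle, h, rotC]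

lemma connectedComponentIn_autSet (hS : 2 ≤ S.ncard) (hT : 2 ≤ Sᶜ.ncard) (hp : p ∈ S)
    (hq : q ∉ S) :
    connectedComponentIn (autSet (bellLagrangian S p q) (bellSection hp hq)) 1 =
      Set.range (torusMap S : ({a : P // a ≠ p ∧ a ≠ q} → Circle) → P → Rot) := by
  have hsub : Set.range (torusMap S : ({a : P // a ≠ p ∧ a ≠ q} → Circle) → P → Rot) ⊆
      autSet (bellLagrangian S p q) (bellSection hp hq) := by
    rintro _ ⟨y, rfl⟩
    exact rotC_mem_autSet hp hq (prod_extendCircle hp hq y) (prod_compl_extendCircle hp hq y)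
  have hone : 1 ∈ Set.range (torusMap S : ({a : P // a ≠ p ∧ a ≠ q} → Circle) → P → Rot) :=
    ⟨1, torusMap_one S⟩
  refine Set.Subset.antisymm (fun g hg => ?_)
    ((isPreconnected_range (continuous_torusMap S)).subset_connectedComponentIn hone hsub)
  have hneg : ∀ a, g a 2 2 ≠ -1 := by
    intro a ha
    have hcont : Continuous fun g : P → Rot => g a 2 2 :=
      (continuous_apply a).matrix_elem 2 2
    have himg := (isPreconnected_connectedComponentIn (x := 1)
      (F := autSet (bellLagrangian S p q) (bellSection hp hq))).image _ hcont.continuousOn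
    obtain ⟨g', hg', h0⟩ := himg.Icc_subset ⟨g, hg, ha⟩
      ⟨1, mem_connectedComponentIn (hsub hone), Matrix.one_apply_eq 2⟩
      (show (0 : ℝ) ∈ Set.Icc (-1) 1 by norm_num)
    have h := autSet_zz hS hT hp hq (connectedComponentIn_subset _ _ hg') a
    simp only at h0
    rw [h0] at h
    norm_num at h
  obtain ⟨z, hzS, hzT, rfl⟩ :=
    exists_eq_rotC_of_mem_autSet hS hT hp hq (connectedComponentIn_subset _ _ hg) hneg
  obtain ⟨y, rfl⟩ := exists_extendCircle_eq hp hq hzS hzT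
  exact ⟨y, rfl⟩

lemma card_ne_and_ne (hpq : p ≠ q) :
    Fintype.card {a : P // a ≠ p ∧ a ≠ q} = Fintype.card P - 2 := by
  rw [Fintype.card_subtype]
  have h : (Finset.univ.filter fun a => a ≠ p ∧ a ≠ q) = ({p, q} : Finset P)ᶜ := by
    ext; simp
  rw [h, Finset.card_compl, Finset.card_pair hpq]

end Automorphisms

/-- **A pure stabilizer state with non-trivial connected automorphism group.** Let
`P = S ⊔ T` with `|S| ≥ 2 ≤ |T|`, `p ∈ S`, `q ∈ T`, and let `L` be the Lagrangian
`⟨z_s + z_p : s ∈ S⟩ + ⟨Σ_{s∈S} x_s + z_q, z_p + Σ_{t∈T} x_t⟩ + ⟨z_t + z_q : t ∈ T⟩`.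
Then for a suitable section `σ` the corresponding stabilizer state is
`|0⟩|0⟩ + |0⟩|1⟩ + |1⟩|0⟩ − |1⟩|1⟩`; the contiguity classes of `L` are exactly `S` and
`T`, both protected, and the connected automorphism group is a torus of dimension
`|P| − 2 > 0`; in particular it is non-trivial. -/
theorem nontrivial_connected_example {P : Type} [Fintype P] [DecidableEq P]
    (S : Set P) (hS : 2 ≤ S.ncard) (hT : 2 ≤ Sᶜ.ncard)
    (p q : P) (hp : p ∈ S) (hq : q ∈ Sᶜ)
    (L : Submodule (ZMod 2) (QV P))
    (hL : L = Submodule.span (ZMod 2)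
      (({v | ∃ s ∈ S, v = zvec s + zvec p} : Set (QV P)) ∪
        ({xsumOn S + zvec q, zvec p + xsumOn Sᶜ} : Set (QV P)) ∪
        ({v | ∃ t ∈ Sᶜ, v = zvec t + zvec q} : Set (QV P)))) :
    ∃ σ : PauliSection L,
      code L σ = Submodule.span ℂ {bellLike S p q} ∧
      (∀ a ∈ S, contigClass L a = S) ∧
      (∀ a ∈ Sᶜ, contigClass L a = Sᶜ) ∧
      (∀ a : P, IsProtected L a) ∧
      Nonempty (↥(connectedComponentIn (autSet L σ) 1) ≃ₜ
        (Fin (Fintype.card P - 2) → Circle)) ∧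
      connectedComponentIn (autSet L σ) 1 ≠ {1} := by
  subst hL
  have hpq : p ≠ q := fun h => hq (h ▸ hp)
  have hp' : p ∉ Sᶜ := fun h => h hp
  have hsymm := bellLagrangian_symm S p q
  have hcomp := connectedComponentIn_autSet hS hT hp hq
  refine ⟨bellSection hp hq, code_bellSection hp hq,
    fun a ha => Set.ext (contig_iff hS hT hp hq ha), fun a ha => ?_, fun a => ?_, ?_, ?_⟩
  · change contigClass (bellLagrangian S p q) a = Sᶜ
    rw [hsymm]
    exact Set.ext (contig_iff hT (by rwa [compl_compl]) hq hp' ha)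
  · change IsProtected (bellLagrangian S p q) a
    by_cases ha : a ∈ S
    · exact isProtected_of_mem hS hq ha
    · rw [hsymm]
      exact isProtected_of_mem hT hp' ha
  · have hemb := ((continuous_torusMap S).isClosedEmbedding
      (torusMap_injective S (p := p) (q := q))).isEmbedding
    have e : {a : P // a ≠ p ∧ a ≠ q} ≃ Fin (Fintype.card P - 2) :=
      Fintype.equivFinOfCardEq (card_ne_and_ne hpq)
    exact ⟨((Homeomorph.setCongr hcomp).trans hemb.toHomeomorph.symm).trans
      (Homeomorph.piCongrLeft (Y := fun _ => Circle) e)⟩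
  · intro h
    obtain ⟨a, ha, hap⟩ := exists_ne_of_two_le hS p
    have haq : a ≠ q := fun h => hq (h ▸ ha)
    have hconst : ∀ y : {a : P // a ≠ p ∧ a ≠ q} → Circle, torusMap S y = 1 := fun y =>
      (hcomp.symm.trans h).subset ⟨y, rfl⟩
    have hy := torusMap_injective S ((hconst fun _ => -1).trans (hconst 1).symm)
    have h1 := congrArg (Subtype.val) (congrFun hy ⟨a, hap, haq⟩)
    have h2 : (-1 : ℂ) = 1 := h1
    norm_num at h2

end Stab
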